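/- Explicit Laplace transform of the marginal: for δ ∈ D, x ≥ 0, t > 0 and λ ≥ 0, E^{Q^δ_x}[ e^{−λ X_t} ] = exp( −λx/(1+2λt) ) · exp( −∫_0^t λ δ_u / (1 + 2λ(t−u)) du ). -/

import Mathlib

open MeasureTheory ProbabilityTheory Filter

noncomputable section

/-- The path space `C(ℝ⁺, ℝ)` modelled as functions `ℝ → ℝ`. -/
abbrev RPath : Type := ℝ → ℝ

/-- The class `D` of nonnegative, measurable, locally bounded, piecewise
continuous functions. -/
def MemD (f : ℝ → ℝ) : Prop :=
  Measurable f ∧ (∀ t, 0 ≤ f t) ∧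
    (∀ T : ℝ, ∃ C : ℝ, ∀ t ∈ Set.Icc (0 : ℝ) T, f t ≤ C) ∧
    ∃ S : Set ℝ, S.Countable ∧ ∀ t ∉ S, ContinuousAt f t

/-- `W` is a standard Brownian motion with respect to the filtration `ℱ`:
it starts at `0`, has continuous paths, is adapted, has Gaussian increments
`W t - W s ∼ N(0, t - s)` that are independent of `ℱ s`. -/
structure IsBrownianMotion {Ω : Type*} [m : MeasurableSpace Ω] (P : Measure Ω)
    (ℱ : Filtration ℝ m) (W : ℝ → Ω → ℝ) : Prop where
  start : ∀ ω, W 0 ω = 0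
  cont : ∀ ω, Continuous fun t => W t ω
  adapted : Adapted ℱ W
  gaussian_increments : ∀ s t : ℝ, 0 ≤ s → s ≤ t →
    P.map (fun ω => W t ω - W s ω) = gaussianReal 0 (Real.toNNReal (t - s))
  indep_increments : ∀ s t : ℝ, 0 ≤ s → s ≤ t →
    Indep (MeasurableSpace.comap (fun ω => W t ω - W s ω) (borel ℝ)) (ℱ s) P

/-- `X` is a (strong) solution of the SDE `dX_t = b(t, X_t) dt + σ(X_t) dW_t`,
`X_0 = x`, formulated through the martingale problem relative to `W`:
`M_t := X_t - x - ∫_0^t b(s, X_s) ds` is a martingale, its quadratic variation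
is `∫_0^t σ(X_s)² ds`, and its covariation with `W` is `∫_0^t σ(X_s) ds`
(the latter characterizes `M_t = ∫_0^t σ(X_s) dW_s`). -/
structure IsSDESolution {Ω : Type*} [m : MeasurableSpace Ω] (P : Measure Ω)
    (ℱ : Filtration ℝ m) (W : ℝ → Ω → ℝ)
    (b : ℝ → ℝ → ℝ) (σ : ℝ → ℝ) (x : ℝ) (X : ℝ → Ω → ℝ) : Prop where
  init : ∀ ω, X 0 ω = x
  cont : ∀ ω, Continuous fun t => X t ω
  adapted : Adapted ℱ X
  drift_mart : Martingale
    (fun t ω => X t ω - x - ∫ s in Set.Ioc (0 : ℝ) t, b s (X s ω)) ℱ P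
  quad_var : Martingale
    (fun t ω => (X t ω - x - ∫ s in Set.Ioc (0 : ℝ) t, b s (X s ω)) ^ 2
      - ∫ s in Set.Ioc (0 : ℝ) t, (σ (X s ω)) ^ 2) ℱ P
  driven_by : Martingale
    (fun t ω => (X t ω - x - ∫ s in Set.Ioc (0 : ℝ) t, b s (X s ω)) * W t ω
      - ∫ s in Set.Ioc (0 : ℝ) t, σ (X s ω)) ℱ P

/-- The drift `(t, y) ↦ 2 β_t y + δ_t` of the generalized squared Bessel process. -/
def gbesqDrift (β δ : ℝ → ℝ) : ℝ → ℝ → ℝ := fun t y => 2 * β t * y + δ t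

/-- The diffusion coefficient `y ↦ 2 √y` of the squared Bessel process. -/
def besqSigma : ℝ → ℝ := fun y => 2 * Real.sqrt y

/-- `X` is a generalized squared Bessel process `GBESQ^{β,δ}_x` driven by `W`. -/
def IsGBESQ {Ω : Type*} [m : MeasurableSpace Ω] (P : Measure Ω)
    (ℱ : Filtration ℝ m) (W : ℝ → Ω → ℝ) (β δ : ℝ → ℝ) (x : ℝ)
    (X : ℝ → Ω → ℝ) : Prop :=
  IsSDESolution P ℱ W (gbesqDrift β δ) besqSigma x X

/-- The law on path space of a process `X`. -/
def pathLaw {Ω : Type*} [m : MeasurableSpace Ω] (P : Measure Ω)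
    (X : ℝ → Ω → ℝ) : Measure RPath :=
  P.map fun ω t => X t ω

/-- A realization of the generalized squared Bessel process `GBESQ^{β,δ}_x`
whose law on path space is `μ`. -/
structure GBESQRealization (β δ : ℝ → ℝ) (x : ℝ) (μ : Measure RPath) where
  (Ω : Type)
  [m : MeasurableSpace Ω]
  (P : Measure Ω)
  (ℱ : Filtration ℝ m)
  (W : ℝ → Ω → ℝ)
  (X : ℝ → Ω → ℝ)
  (prob : IsProbabilityMeasure P)
  (bm : IsBrownianMotion P ℱ W)
  (sol : IsGBESQ P ℱ W β δ x X)
  (law : μ = pathLaw P X)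

/-- `μ` is the law `{}^β Q^δ_x` of the generalized squared Bessel process with
drift function `β`, dimension function `δ` and initial value `x`. -/
def IsGBESQLaw (β δ : ℝ → ℝ) (x : ℝ) (μ : Measure RPath) : Prop :=
  Nonempty (GBESQRealization β δ x μ)

/-- Convolution of two laws on path space: the law of the pathwise sum of
independent copies. -/
def mconv (μ ν : Measure RPath) : Measure RPath :=
  (μ.prod ν).map fun p => p.1 + p.2


section GBESQAux

set_option linter.unusedSectionVars false

/-- Telescoping: a function with super-linear increments bound is nonincreasing. -/
lemma telescoping_le (f : ℝ → ℝ) (T K : ℝ) (hT : 0 < T)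
    (hf : ∀ s k : ℝ, 0 ≤ s → 0 < k → k ≤ 1 → s + k ^ 4 ≤ T → f (s + k ^ 4) ≤ f s + K * k ^ 5) :
    f T ≤ f 0 := by
  have key : ∀ n : ℕ, 0 < n → T ≤ n → f T ≤ f 0 + |K| * T * Real.sqrt (Real.sqrt (T / n)) := by
    intro n hn hTn
    have hn' : (0 : ℝ) < n := by exact_mod_cast hn
    set k := Real.sqrt (Real.sqrt (T / n)) with hk
    have hq : 0 < T / n := by positivity
    have hk0 : 0 < k := by positivity
    have hk4 : k ^ 4 = T / n := by
      have : k ^ 4 = (k ^ 2) ^ 2 := by ring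
      rw [this, hk, Real.sq_sqrt (by positivity), Real.sq_sqrt (by positivity)]
    have hk1 : k ≤ 1 := by
      rw [hk]
      have : T / n ≤ 1 := by rw [div_le_one hn']; exact hTn
      have h2 : Real.sqrt (T / n) ≤ 1 := Real.sqrt_le_one.mpr this
      exact Real.sqrt_le_one.mpr h2
    have step : ∀ i : ℕ, i ≤ n → f (i * k ^ 4) ≤ f 0 + i * (K * k ^ 5) := by
      intro i
      induction i with
      | zero => intro _; simp
      | succ i ih =>
        intro hi
        have h1 := ih (by omega)
        have hle : (i : ℝ) * k ^ 4 + k ^ 4 ≤ T := by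
          have : ((i : ℝ) + 1) ≤ n := by exact_mod_cast hi
          calc (i : ℝ) * k ^ 4 + k ^ 4 = (i + 1) * k ^ 4 := by ring
            _ ≤ n * k ^ 4 := by gcongr
            _ = T := by rw [hk4]; field_simp
        have h2 := hf (i * k ^ 4) k (by positivity) hk0 hk1 hle
        have e : ((i + 1 : ℕ) : ℝ) * k ^ 4 = i * k ^ 4 + k ^ 4 := by push_cast; ring
        rw [e]
        push_cast
        linarith
    have h3 := step n le_rfl
    have e : (n : ℝ) * k ^ 4 = T := by rw [hk4]; field_simp
    rw [e] at h3
    have e2 : (n : ℝ) * (K * k ^ 5) = K * (T * k) := by rw [← e]; ring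
    rw [e2] at h3
    have : K * (T * k) ≤ |K| * (T * k) := by
      apply mul_le_mul_of_nonneg_right (le_abs_self K); positivity
    linarith
  have lim : Tendsto (fun n : ℕ => f 0 + |K| * T * Real.sqrt (Real.sqrt (T / n))) atTop
      (nhds (f 0 + |K| * T * Real.sqrt (Real.sqrt 0))) := by
    have h0 : Tendsto (fun n : ℕ => T / (n : ℝ)) atTop (nhds 0) :=
      tendsto_const_div_atTop_nhds_zero_nat T
    exact (((Real.continuous_sqrt.tendsto _).comp ((Real.continuous_sqrt.tendsto _).comp h0)).const_mul
      (|K| * T)).const_add (f 0)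
  have h := ge_of_tendsto lim (b := f T) (by
    filter_upwards [eventually_gt_atTop 0, eventually_ge_atTop (Nat.ceil T)] with n h1 h2
    exact key n h1 (Nat.ceil_le.mp h2))
  simpa using h

variable {Ω : Type} [m : MeasurableSpace Ω] {P : Measure Ω} [IsProbabilityMeasure P]
  {ℱ : Filtration ℝ m}

lemma mart_orth {N : ℝ → Ω → ℝ} (hN : Martingale N ℱ P) {s t : ℝ} (hst : s ≤ t) {g : Ω → ℝ}
    (hg : Measurable[ℱ s] g) (hi : Integrable (fun ω => g ω * (N t ω - N s ω)) P) :
    ∫ ω, g ω * (N t ω - N s ω) ∂P = 0 := by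
  have hgs : StronglyMeasurable[ℱ s] g := hg.stronglyMeasurable
  have hd : Integrable (N t - N s) P := (hN.integrable t).sub (hN.integrable s)
  have h1 : P[g * (N t - N s) | ℱ s] =ᵐ[P] g * P[N t - N s | ℱ s] :=
    condExp_mul_of_stronglyMeasurable_left hgs hi hd
  have h2 : P[N t - N s | ℱ s] =ᵐ[P] 0 := by
    have h3 := condExp_sub (hN.integrable t) (hN.integrable s) (ℱ s)
    have h4 := hN.condExp_ae_eq hst
    have h5 := hN.condExp_ae_eq (le_refl s)
    filter_upwards [h3, h4, h5] with ω a b c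
    rw [a]; simp [b, c]
  have h6 : ∫ ω, (g * (N t - N s)) ω ∂P = ∫ ω, (P[g * (N t - N s) | ℱ s]) ω ∂P :=
    (integral_condExp (ℱ.le s)).symm
  have h7 : ∫ ω, (P[g * (N t - N s) | ℱ s]) ω ∂P = ∫ ω, (0 : ℝ) ∂P := by
    apply integral_congr_ae
    filter_upwards [h1, h2] with ω a b
    rw [a]; simp [b]
  rw [h7] at h6
  simpa using h6

/-- fourth moment of standard Gaussian -/
def gc4 : ℝ := ∫ y, y ^ 4 ∂(gaussianReal 0 1)

lemma gc4_nonneg : 0 ≤ gc4 := integral_nonneg fun y => by positivity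

lemma integrable_pow_gaussian (n : ℕ) (v : NNReal) :
    Integrable (fun y : ℝ => y ^ n) (gaussianReal 0 v) := by
  have h := (memLp_id_gaussianReal (μ := 0) (v := v) (n : NNReal))
  have := h.integrable_norm_pow'
  refine (integrable_norm_iff (by fun_prop)).mp ?_
  simpa [norm_pow] using this

lemma gaussian_m4 (h : ℝ) (hh : 0 ≤ h) :
    ∫ y, y ^ 4 ∂(gaussianReal 0 h.toNNReal) = gc4 * h ^ 2 := by
  have e : (gaussianReal 0 1).map (Real.sqrt h * ·) = gaussianReal 0 h.toNNReal := by
    rw [gaussianReal_map_const_mul]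
    congr 1
    · simp
    · ext; simp [hh]
  rw [← e, integral_map (by fun_prop) (by fun_prop)]
  simp only [mul_pow]
  rw [integral_const_mul]
  have : Real.sqrt h ^ 4 = h ^ 2 := by
    rw [show Real.sqrt h ^ 4 = (Real.sqrt h ^ 2) ^ 2 by ring, Real.sq_sqrt hh]
  rw [this, gc4, mul_comm]

lemma gaussian_m2 (h : ℝ) (hh : 0 ≤ h) :
    ∫ y, y ^ 2 ∂(gaussianReal 0 h.toNNReal) = h := by
  have h1 := variance_fun_id_gaussianReal (μ := 0) (v := h.toNNReal)
  rw [variance_eq_integral (by fun_prop)] at h1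
  simpa [hh] using h1

variable {W : ℝ → Ω → ℝ}

lemma bm_meas (hW : IsBrownianMotion P ℱ W) (s : ℝ) : Measurable (W s) :=
  (hW.adapted s).mono (ℱ.le s) le_rfl

lemma bm_pow_int (hW : IsBrownianMotion P ℱ W) {s t : ℝ} (hs : 0 ≤ s) (hst : s ≤ t) (n : ℕ) :
    Integrable (fun ω => (W t ω - W s ω) ^ n) P := by
  have hm : Measurable (fun ω => W t ω - W s ω) := (bm_meas hW t).sub (bm_meas hW s)
  have := integrable_pow_gaussian n (t - s).toNNReal
  rw [← hW.gaussian_increments s t hs hst] at this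
  exact (integrable_map_measure (measurable_id.pow_const n).aestronglyMeasurable hm.aemeasurable).mp this

lemma bm_indep (hW : IsBrownianMotion P ℱ W) {s t : ℝ} (hs : 0 ≤ s) (hst : s ≤ t) {Y : Ω → ℝ}
    (hY : Measurable[ℱ s] Y) (n : ℕ) : IndepFun Y (fun ω => (W t ω - W s ω) ^ n) P := by
  have h := hW.indep_increments s t hs hst
  have h1 : IndepFun (fun ω => W t ω - W s ω) Y P := by
    rw [IndepFun_iff_Indep]
    refine indep_of_indep_of_le_right h ?_
    exact hY.comap_le
  exact (h1.comp (φ := fun y => y ^ n) (ψ := id) (by fun_prop) measurable_id).symm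

lemma bm_mul_int (hW : IsBrownianMotion P ℱ W) {s t : ℝ} (hs : 0 ≤ s) (hst : s ≤ t) {Y : Ω → ℝ}
    (hY : Measurable[ℱ s] Y) (hYi : Integrable Y P) (n : ℕ) :
    Integrable (fun ω => Y ω * (W t ω - W s ω) ^ n) P :=
  (bm_indep hW hs hst hY n).integrable_mul hYi (bm_pow_int hW hs hst n)

lemma bm_mul_eq (hW : IsBrownianMotion P ℱ W) {s t : ℝ} (hs : 0 ≤ s) (hst : s ≤ t) {Y : Ω → ℝ}
    (hY : Measurable[ℱ s] Y) (n : ℕ) :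
    ∫ ω, Y ω * (W t ω - W s ω) ^ n ∂P
      = (∫ ω, Y ω ∂P) * ∫ y, y ^ n ∂(gaussianReal 0 (t - s).toNNReal) := by
  have hm : Measurable (fun ω => W t ω - W s ω) := (bm_meas hW t).sub (bm_meas hW s)
  rw [(bm_indep hW hs hst hY n).integral_fun_mul_eq_mul_integral
    (hY.mono (ℱ.le s) le_rfl).aestronglyMeasurable (hm.pow_const n).aestronglyMeasurable]
  congr 1
  rw [← hW.gaussian_increments s t hs hst, integral_map hm.aemeasurable (by fun_prop)]

lemma bm_mul_one (hW : IsBrownianMotion P ℱ W) {s t : ℝ} (hs : 0 ≤ s) (hst : s ≤ t) {Y : Ω → ℝ}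
    (hY : Measurable[ℱ s] Y) :
    ∫ ω, Y ω * (W t ω - W s ω) ∂P = 0 := by
  have := bm_mul_eq hW hs hst hY 1
  simpa using this

lemma bm_mul_two (hW : IsBrownianMotion P ℱ W) {s t : ℝ} (hs : 0 ≤ s) (hst : s ≤ t) {Y : Ω → ℝ}
    (hY : Measurable[ℱ s] Y) :
    ∫ ω, Y ω * (W t ω - W s ω) ^ 2 ∂P = (∫ ω, Y ω ∂P) * (t - s) := by
  rw [bm_mul_eq hW hs hst hY 2, gaussian_m2 _ (by linarith)]

lemma bm_mul_four (hW : IsBrownianMotion P ℱ W) {s t : ℝ} (hs : 0 ≤ s) (hst : s ≤ t) {Y : Ω → ℝ}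
    (hY : Measurable[ℱ s] Y) :
    ∫ ω, Y ω * (W t ω - W s ω) ^ 4 ∂P = (∫ ω, Y ω ∂P) * (gc4 * (t - s) ^ 2) := by
  rw [bm_mul_eq hW hs hst hY 4, gaussian_m4 _ (by linarith)]


/-- `f` is integrable with expectation `c`. -/
def HasE (P : Measure Ω) (f : Ω → ℝ) (c : ℝ) : Prop := Integrable f P ∧ ∫ ω, f ω ∂P = c

/-- `f` is integrable with expectation at most `c`. -/
def HasLE (P : Measure Ω) (f : Ω → ℝ) (c : ℝ) : Prop := Integrable f P ∧ ∫ ω, f ω ∂P ≤ c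

lemma HasE.add {f g : Ω → ℝ} {a b : ℝ} (hf : HasE P f a) (hg : HasE P g b) :
    HasE P (fun ω => f ω + g ω) (a + b) :=
  ⟨hf.1.add hg.1, by rw [integral_add hf.1 hg.1, hf.2, hg.2]⟩

lemma HasE.smul {f : Ω → ℝ} {a : ℝ} (hf : HasE P f a) (c : ℝ) :
    HasE P (fun ω => c * f ω) (c * a) :=
  ⟨hf.1.const_mul c, by rw [integral_const_mul, hf.2]⟩

lemma HasE.congr {f g : Ω → ℝ} {a : ℝ} (hf : HasE P f a) (h : ∀ ω, f ω = g ω) : HasE P g a := by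
  have : f = g := funext h
  rwa [← this]

lemma HasE.hle {f : Ω → ℝ} {a : ℝ} (hf : HasE P f a) : HasLE P f a := ⟨hf.1, hf.2.le⟩

lemma HasLE.const (c : ℝ) : HasLE P (fun _ => c) c := ⟨integrable_const c, by simp⟩

lemma HasLE.add {f g : Ω → ℝ} {a b : ℝ} (hf : HasLE P f a) (hg : HasLE P g b) :
    HasLE P (fun ω => f ω + g ω) (a + b) :=
  ⟨hf.1.add hg.1, by rw [integral_add hf.1 hg.1]; exact add_le_add hf.2 hg.2⟩

lemma HasLE.smul {f : Ω → ℝ} {a c : ℝ} (hf : HasLE P f a) (hc : 0 ≤ c) :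
    HasLE P (fun ω => c * f ω) (c * a) :=
  ⟨hf.1.const_mul c, by rw [integral_const_mul]; exact mul_le_mul_of_nonneg_left hf.2 hc⟩

lemma HasLE.le {f : Ω → ℝ} {a b : ℝ} (hf : HasLE P f a) (h : a ≤ b) : HasLE P f b :=
  ⟨hf.1, hf.2.trans h⟩

lemma HasLE.mono {f g : Ω → ℝ} {a : ℝ} (hg : HasLE P g a) (hf : Measurable f)
    (h : ∀ ω, |f ω| ≤ g ω) : HasLE P f a := by
  have hi : Integrable f P := hg.1.mono' hf.aestronglyMeasurable (Eventually.of_forall h)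
  exact ⟨hi, (integral_mono hi hg.1 fun ω => (le_abs_self _).trans (h ω)).trans hg.2⟩

/-- Auxiliary reformulation of the martingale problem. -/
structure Setup (P : Measure Ω) (ℱ : Filtration ℝ m) (W X M : ℝ → Ω → ℝ) (A : ℝ → ℝ)
    (x T C : ℝ) : Prop where
  bm : IsBrownianMotion P ℱ W
  cont : ∀ ω, Continuous fun t => X t ω
  adapted : Adapted ℱ X
  hX : ∀ s ω, X s ω = x + A s + M s ω
  hx : 0 ≤ x
  hC : 0 ≤ C
  hT : 0 < T
  A0 : A 0 = 0
  Amono : ∀ s t, 0 ≤ s → s ≤ t → A s ≤ A t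
  Alip : ∀ s t, 0 ≤ s → s ≤ t → t ≤ T → A t - A s ≤ C * (t - s)
  M0 : ∀ ω, M 0 ω = 0
  hM : Martingale M ℱ P
  hQ : Martingale (fun t ω => (M t ω) ^ 2 - ∫ s in Set.Ioc (0 : ℝ) t, (besqSigma (X s ω)) ^ 2) ℱ P
  hD : Martingale (fun t ω => (M t ω) * W t ω - ∫ s in Set.Ioc (0 : ℝ) t, besqSigma (X s ω)) ℱ P

lemma sigma_cont : Continuous besqSigma := by unfold besqSigma; fun_prop

lemma sigma_nonneg (y : ℝ) : 0 ≤ besqSigma y := by unfold besqSigma; positivity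

lemma sigma_sq (y : ℝ) : besqSigma y ^ 2 = 4 * max y 0 := by
  unfold besqSigma
  rw [mul_pow]
  rcases le_total 0 y with h | h
  · rw [Real.sq_sqrt h, max_eq_left h]; norm_num
  · rw [Real.sqrt_eq_zero_of_nonpos h, max_eq_right h]; norm_num

lemma sigma_sq_le (y : ℝ) : besqSigma y ^ 2 ≤ 4 * |y| := by
  rw [sigma_sq]
  have : max y 0 ≤ |y| := max_le (le_abs_self y) (abs_nonneg y)
  linarith

lemma sigma_pow_four_le (y : ℝ) : besqSigma y ^ 4 ≤ 16 * y ^ 2 := by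
  have h := sigma_sq_le y
  have : besqSigma y ^ 4 = (besqSigma y ^ 2) ^ 2 := by ring
  rw [this]
  calc (besqSigma y ^ 2) ^ 2 ≤ (4 * |y|) ^ 2 := by gcongr
    _ = 16 * y ^ 2 := by rw [mul_pow, sq_abs]; norm_num

lemma sigma_diff_sq (y z : ℝ) : (besqSigma y - besqSigma z) ^ 2 ≤ 4 * |y - z| := by
  have main : ∀ a b : ℝ, a ≤ b → (besqSigma b - besqSigma a) ^ 2 ≤ 4 * (b - a) := by
    intro a b hab
    have h1 : besqSigma a ≤ besqSigma b := by
      unfold besqSigma; have := Real.sqrt_le_sqrt hab; linarith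
    have h2 := sigma_nonneg a
    have h3 := sigma_sq a
    have h4 := sigma_sq b
    have h5 : max b 0 - max a 0 ≤ b - a := by
      rcases le_total 0 a with h | h
      · rw [max_eq_left h, max_eq_left (h.trans hab)]
      · rw [max_eq_right h]
        rcases le_total 0 b with h' | h'
        · rw [max_eq_left h']; linarith
        · rw [max_eq_right h']; linarith
    nlinarith
  rcases le_total y z with h | h
  · rw [abs_of_nonpos (by linarith)]
    have := main y z h
    nlinarith
  · rw [abs_of_nonneg (by linarith)]
    exact main z y h

/-- Fubini helper -/
lemma fubini_bound {H : ℝ → Ω → ℝ} (hc : ∀ ω, Continuous fun u => H u ω)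
    (hm : ∀ u, Measurable (H u)) {s t L : ℝ} (hst : s ≤ t)
    (hi : ∀ u ∈ Set.Ioc s t, Integrable (H u) P)
    (hL : ∀ u ∈ Set.Ioc s t, ∫ ω, |H u ω| ∂P ≤ L) :
    Integrable (fun ω => ∫ u in Set.Ioc s t, H u ω) P ∧
      ∫ ω, (∫ u in Set.Ioc s t, H u ω) ∂P ≤ L * (t - s) := by
  have hmeas : Measurable (Function.uncurry H) :=
    measurable_uncurry_of_continuous_of_measurable hc hm
  have hnm : StronglyMeasurable (fun u => ∫ ω, ‖H u ω‖ ∂P) :=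
    (hmeas.norm.stronglyMeasurable).integral_prod_right
  have hfi : IsFiniteMeasure (volume.restrict (Set.Ioc s t)) := inferInstance
  have hintg : Integrable (fun u => ∫ ω, ‖H u ω‖ ∂P) (volume.restrict (Set.Ioc s t)) := by
    refine Integrable.of_bound hnm.aestronglyMeasurable L ?_
    rw [ae_restrict_iff' measurableSet_Ioc]
    refine Eventually.of_forall fun u hu => ?_
    rw [Real.norm_of_nonneg (integral_nonneg fun ω => norm_nonneg _)]
    exact hL u hu
  have hprod : Integrable (Function.uncurry H) ((volume.restrict (Set.Ioc s t)).prod P) := by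
    rw [integrable_prod_iff hmeas.aestronglyMeasurable]
    refine ⟨?_, hintg⟩
    rw [ae_restrict_iff' measurableSet_Ioc]
    exact Eventually.of_forall fun u hu => hi u hu
  refine ⟨hprod.integral_prod_right, ?_⟩
  rw [← integral_integral_swap hprod]
  have h1 : ∫ u in Set.Ioc s t, ∫ ω, H u ω ∂P ≤ ∫ u in Set.Ioc s t, L := by
    apply setIntegral_mono_on hprod.integral_prod_left (integrable_const L) measurableSet_Ioc
    intro u hu
    exact (integral_mono (hi u hu) (hi u hu).abs fun ω => le_abs_self _).trans (hL u hu)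
  refine h1.trans (le_of_eq ?_)
  rw [setIntegral_const]
  simp [Measure.real, hst]
  ring

namespace Setup

variable {X M : ℝ → Ω → ℝ} {A : ℝ → ℝ} {x T C : ℝ}

lemma Xm (S : Setup P ℱ W X M A x T C) (s : ℝ) : Measurable (X s) :=
  (S.adapted s).mono (ℱ.le s) le_rfl

lemma Mm (S : Setup P ℱ W X M A x T C) (s : ℝ) : Measurable[ℱ s] (M s) :=
  (S.hM.stronglyAdapted s).measurable

lemma Mm' (S : Setup P ℱ W X M A x T C) (s : ℝ) : Measurable (M s) :=
  (S.Mm s).mono (ℱ.le s) le_rfl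

lemma Xi (S : Setup P ℱ W X M A x T C) (s : ℝ) : Integrable (X s) P := by
  have : X s = fun ω => x + A s + M s ω := funext (S.hX s)
  rw [this]
  exact (integrable_const _).add (S.hM.integrable s)

lemma Abd (S : Setup P ℱ W X M A x T C) {s : ℝ} (hs : 0 ≤ s) (hsT : s ≤ T) :
    0 ≤ A s ∧ A s ≤ C * T := by
  have h1 := S.Amono 0 s le_rfl hs
  have h2 := S.Alip 0 s le_rfl hs hsT
  have h3 := S.hC
  rw [S.A0] at h1 h2
  exact ⟨h1, by nlinarith⟩

lemma EX (S : Setup P ℱ W X M A x T C) : ∃ K, 0 ≤ K ∧ ∀ s, 0 ≤ s → s ≤ T →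
    ∫ ω, |X s ω| ∂P ≤ K := by
  refine ⟨x + C * T + ∫ ω, |M T ω| ∂P, ?_, ?_⟩
  · have := S.hx; have := S.hC; have := S.hT
    have : 0 ≤ ∫ ω, |M T ω| ∂P := integral_nonneg fun ω => abs_nonneg _
    positivity
  intro s hs hsT
  have h1 : ∫ ω, |M s ω| ∂P ≤ ∫ ω, |M T ω| ∂P := by
    refine le_trans (le_of_eq ?_) (integral_abs_condExp_le (m := ℱ s) (M T))
    apply integral_congr_ae
    filter_upwards [S.hM.condExp_ae_eq hsT] with ω h
    rw [h]
  obtain ⟨a1, a2⟩ := S.Abd hs hsT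
  have h2 : ∫ ω, |X s ω| ∂P ≤ ∫ ω, (x + C * T + |M s ω|) ∂P := by
    apply integral_mono (S.Xi s).abs ((integrable_const _).add (S.hM.integrable s).abs)
    intro ω
    have : |X s ω| ≤ |x + A s| + |M s ω| := by rw [S.hX]; exact abs_add_le _ _
    have h3 : |x + A s| = x + A s := abs_of_nonneg (by have := S.hx; linarith)
    simp only [Pi.add_apply]
    linarith
  rw [integral_add (integrable_const _) (S.hM.integrable s).abs] at h2
  simp at h2
  linarith

lemma intS2 (S : Setup P ℱ W X M A x T C) : ∃ K, 0 ≤ K ∧ ∀ s t, 0 ≤ s → s ≤ t → t ≤ T →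
    Integrable (fun ω => ∫ u in Set.Ioc s t, besqSigma (X u ω) ^ 2) P ∧
    ∫ ω, (∫ u in Set.Ioc s t, besqSigma (X u ω) ^ 2) ∂P ≤ K * (t - s) := by
  obtain ⟨K, hK, h⟩ := S.EX
  refine ⟨4 * K, by positivity, fun s t hs hst htT => ?_⟩
  have hdom : ∀ u, Integrable (fun ω => besqSigma (X u ω) ^ 2) P := fun u => by
    refine ((S.Xi u).abs.const_mul 4).mono' ((sigma_cont.measurable.comp (S.Xm u)).pow_const 2).aestronglyMeasurable ?_
    refine Eventually.of_forall fun ω => ?_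
    rw [Real.norm_of_nonneg (by positivity)]
    exact sigma_sq_le _
  apply fubini_bound (H := fun u ω => besqSigma (X u ω) ^ 2)
  · intro ω; exact (sigma_cont.comp (S.cont ω)).pow 2
  · intro u; exact (sigma_cont.measurable.comp (S.Xm u)).pow_const 2
  · exact hst
  · intro u _; exact hdom u
  · intro u hu
    calc ∫ ω, |besqSigma (X u ω) ^ 2| ∂P ≤ ∫ ω, 4 * |X u ω| ∂P := by
          apply integral_mono (hdom u).abs ((S.Xi u).abs.const_mul 4)
          intro ω
          simp only
          rw [abs_of_nonneg (by positivity)]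
          exact sigma_sq_le _
      _ = 4 * ∫ ω, |X u ω| ∂P := integral_const_mul _ _
      _ ≤ 4 * K := by
          have := h u (by linarith [hu.1]) (by linarith [hu.2])
          linarith

lemma M2i (S : Setup P ℱ W X M A x T C) {s : ℝ} (hs : 0 ≤ s) (hsT : s ≤ T) :
    Integrable (fun ω => M s ω ^ 2) P := by
  obtain ⟨K, hK, h⟩ := S.intS2
  have h1 := (h 0 s le_rfl hs hsT).1
  have h2 := (S.hQ.integrable s).add h1
  refine h2.congr (Eventually.of_forall fun ω => ?_)
  simp

lemma splitInt {f : ℝ → ℝ} (hf : Continuous f) {s t : ℝ} (hs : 0 ≤ s) (hst : s ≤ t) :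
    ∫ u in Set.Ioc (0 : ℝ) t, f u = (∫ u in Set.Ioc (0 : ℝ) s, f u) + ∫ u in Set.Ioc s t, f u := by
  rw [← intervalIntegral.integral_of_le hs, ← intervalIntegral.integral_of_le hst,
    ← intervalIntegral.integral_of_le (hs.trans hst)]
  exact (intervalIntegral.integral_add_adjacent_intervals (hf.intervalIntegrable _ _)
    (hf.intervalIntegrable _ _)).symm

lemma prodi {f g : Ω → ℝ} (hf : Measurable f) (hg : Measurable g)
    (hf2 : Integrable (fun ω => f ω ^ 2) P) (hg2 : Integrable (fun ω => g ω ^ 2) P) :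
    Integrable (fun ω => f ω * g ω) P := by
  refine (hf2.add hg2).mono' (hf.mul hg).aestronglyMeasurable (Eventually.of_forall fun ω => ?_)
  rw [Real.norm_eq_abs, abs_le]
  simp only [Pi.add_apply]
  constructor <;> nlinarith [sq_nonneg (f ω + g ω), sq_nonneg (f ω - g ω), sq_nonneg (f ω), sq_nonneg (g ω)]

lemma sq_subi {f g : Ω → ℝ} (hf : Measurable f) (hg : Measurable g)
    (hf2 : Integrable (fun ω => f ω ^ 2) P) (hg2 : Integrable (fun ω => g ω ^ 2) P) :
    Integrable (fun ω => (f ω - g ω) ^ 2) P := by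
  refine ((hf2.add hg2).const_mul 2).mono' ((hf.sub hg).pow_const 2).aestronglyMeasurable (Eventually.of_forall fun ω => ?_)
  rw [Real.norm_of_nonneg (by positivity)]
  simp only [Pi.add_apply]
  nlinarith [sq_nonneg (f ω + g ω)]

lemma dM2i (S : Setup P ℱ W X M A x T C) {s t : ℝ} (hs : 0 ≤ s) (hst : s ≤ t) (htT : t ≤ T) :
    Integrable (fun ω => (M t ω - M s ω) ^ 2) P :=
  sq_subi (S.Mm' t) (S.Mm' s) (S.M2i (hs.trans hst) htT) (S.M2i hs (hst.trans htT))

lemma M_orth (S : Setup P ℱ W X M A x T C) {s t : ℝ} (hs : 0 ≤ s) (hst : s ≤ t) (htT : t ≤ T)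
    {g : Ω → ℝ} (hg : Measurable[ℱ s] g) (hg2 : Integrable (fun ω => g ω ^ 2) P) :
    Integrable (fun ω => g ω * (M t ω - M s ω)) P ∧ ∫ ω, g ω * (M t ω - M s ω) ∂P = 0 := by
  have hi := prodi (hg.mono (ℱ.le s) le_rfl) ((S.Mm' t).sub (S.Mm' s)) hg2 (S.dM2i hs hst htT)
  exact ⟨hi, mart_orth S.hM hst hg hi⟩

lemma dM2_eq (S : Setup P ℱ W X M A x T C) {s t : ℝ} (hs : 0 ≤ s) (hst : s ≤ t) (htT : t ≤ T) :
    ∫ ω, (M t ω - M s ω) ^ 2 ∂P = ∫ ω, (∫ u in Set.Ioc s t, besqSigma (X u ω) ^ 2) ∂P := by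
  obtain ⟨K, hK, h⟩ := S.intS2
  obtain ⟨i1, -⟩ := h s t hs hst htT
  obtain ⟨i2, e2⟩ := S.M_orth hs hst htT (S.Mm s) (S.M2i hs (hst.trans htT))
  have i3 : Integrable (fun ω => ((M t ω) ^ 2 - ∫ u in Set.Ioc (0 : ℝ) t, (besqSigma (X u ω)) ^ 2) -
      ((M s ω) ^ 2 - ∫ u in Set.Ioc (0 : ℝ) s, (besqSigma (X u ω)) ^ 2)) P :=
    (S.hQ.integrable t).sub (S.hQ.integrable s)
  have e3 : ∫ ω, (((M t ω) ^ 2 - ∫ u in Set.Ioc (0 : ℝ) t, (besqSigma (X u ω)) ^ 2) -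
      ((M s ω) ^ 2 - ∫ u in Set.Ioc (0 : ℝ) s, (besqSigma (X u ω)) ^ 2)) ∂P = 0 := by
    have := mart_orth S.hQ hst (g := fun _ => 1) measurable_const (by simpa only [one_mul] using i3)
    simpa only [one_mul] using this
  have : ∀ ω, (M t ω - M s ω) ^ 2 =
      ((((M t ω) ^ 2 - ∫ u in Set.Ioc (0 : ℝ) t, (besqSigma (X u ω)) ^ 2) -
      ((M s ω) ^ 2 - ∫ u in Set.Ioc (0 : ℝ) s, (besqSigma (X u ω)) ^ 2))
      + ∫ u in Set.Ioc s t, besqSigma (X u ω) ^ 2) + (-2) * (M s ω * (M t ω - M s ω)) := by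
    intro ω
    rw [splitInt (f := fun u => besqSigma (X u ω) ^ 2) ((sigma_cont.comp (S.cont ω)).pow 2) hs hst]
    ring
  have q1 : HasE P _ _ := ⟨i3, e3⟩
  have q2 : HasE P _ _ := ⟨i2, e2⟩
  have q3 : HasE P _ _ := ⟨i1, rfl⟩
  have hh := ((q1.add q3).add (q2.smul (-2))).congr fun ω => (this ω).symm
  rw [hh.2]
  simp

lemma EX2 (S : Setup P ℱ W X M A x T C) : ∃ K, 0 ≤ K ∧ ∀ s, 0 ≤ s → s ≤ T →
    HasLE P (fun ω => X s ω ^ 2) K := by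
  obtain ⟨K, hK, h⟩ := S.intS2
  have hT := S.hT
  have hC := S.hC
  have hx := S.hx
  refine ⟨2 * (x + C * T) ^ 2 + 2 * (K * T), by positivity, fun s hs hsT => ?_⟩
  have h1 : HasLE P (fun ω => M s ω ^ 2) (K * T) := by
    refine ⟨S.M2i hs hsT, ?_⟩
    have h2 := S.dM2_eq le_rfl hs hsT
    have h3 := (h 0 s le_rfl hs hsT).2
    simp only [S.M0, sub_zero] at h2 h3
    rw [h2]
    nlinarith
  obtain ⟨a1, a2⟩ := S.Abd hs hsT
  refine ((HasLE.const (2 * (x + C * T) ^ 2)).add (h1.smul (c := 2) (by norm_num))).mono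
    ((S.Xm s).pow_const 2) fun ω => ?_
  rw [abs_of_nonneg (by positivity), S.hX]
  have h4 : (x + A s) ^ 2 ≤ (x + C * T) ^ 2 := by gcongr
  nlinarith [sq_nonneg (x + A s - M s ω)]

lemma dX1 (S : Setup P ℱ W X M A x T C) : ∃ K, 0 ≤ K ∧ ∀ s u k, 0 ≤ s → s ≤ u → 0 < k → k ≤ 1 →
    u ≤ s + k ^ 4 → u ≤ T → HasLE P (fun ω => |X u ω - X s ω|) (K * k ^ 2) := by
  obtain ⟨K, hK, h⟩ := S.intS2
  have hC := S.hC
  refine ⟨C + 1 + K, by positivity, fun s u k hs hsu hk hk1 huk huT => ?_⟩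
  have h1 : HasLE P (fun ω => (M u ω - M s ω) ^ 2) (K * k ^ 4) := by
    refine ⟨S.dM2i hs hsu huT, ?_⟩
    rw [S.dM2_eq hs hsu huT]
    refine (h s u hs hsu huT).2.trans ?_
    gcongr
    linarith
  have hle : k ^ 4 ≤ k ^ 2 := pow_le_pow_of_le_one hk.le hk1 (by norm_num)
  have h2 := ((HasLE.const (P := P) (C * k ^ 2 + k ^ 2)).add
    (h1.smul (c := (k ^ 2)⁻¹) (by positivity))).mono
    (f := fun ω => |X u ω - X s ω|) ((S.Xm u).sub (S.Xm s)).abs (fun ω => ?_)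
  · refine h2.le (le_of_eq ?_)
    field_simp
  · rw [abs_abs, S.hX, S.hX]
    have a1 := S.Amono s u hs hsu
    have a2 := S.Alip s u hs hsu huT
    have a3 : C * (u - s) ≤ C * k ^ 2 := by gcongr; linarith
    have a4 : |x + A u + M u ω - (x + A s + M s ω)| ≤ (A u - A s) + |M u ω - M s ω| := by
      have e : x + A u + M u ω - (x + A s + M s ω) = (A u - A s) + (M u ω - M s ω) := by ring
      rw [e]
      refine (abs_add_le _ _).trans ?_
      rw [abs_of_nonneg (by linarith : 0 ≤ A u - A s)]
    have a5 : |M u ω - M s ω| ≤ k ^ 2 + (k ^ 2)⁻¹ * (M u ω - M s ω) ^ 2 := by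
      rw [← sq_abs (M u ω - M s ω)]
      set y := |M u ω - M s ω|
      have hy : 0 ≤ y := abs_nonneg _
      have : k ^ 2 + (k ^ 2)⁻¹ * y ^ 2 - y = ((k ^ 2 - y) ^ 2 + k ^ 2 * y) / k ^ 2 := by
        field_simp; ring
      have h0 : 0 ≤ ((k ^ 2 - y) ^ 2 + k ^ 2 * y) / k ^ 2 := by positivity
      linarith
    linarith

lemma four_i {f g h : Ω → ℝ} (hf : Measurable f) (hg : Measurable g) (hh : Measurable h)
    (hf4 : Integrable (fun ω => f ω ^ 4) P) (hg4 : Integrable (fun ω => g ω ^ 4) P)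
    (hh2 : Integrable (fun ω => h ω ^ 2) P) :
    Integrable (fun ω => f ω * g ω * h ω) P := by
  refine prodi (hf.mul hg) hh ?_ hh2
  refine (prodi (hf.pow_const 2) (hg.pow_const 2) ?_ ?_).congr
    (Eventually.of_forall fun ω => by simp only [mul_pow])
  · exact hf4.congr (Eventually.of_forall fun ω => by simp only; ring)
  · exact hg4.congr (Eventually.of_forall fun ω => by simp only; ring)

lemma Gm (S : Setup P ℱ W X M A x T C) (s : ℝ) : Measurable[ℱ s] (fun ω => besqSigma (X s ω)) :=
  sigma_cont.measurable.comp (S.adapted s)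

lemma Gm' (S : Setup P ℱ W X M A x T C) (s : ℝ) : Measurable (fun ω => besqSigma (X s ω)) :=
  sigma_cont.measurable.comp (S.Xm s)

lemma G2i (S : Setup P ℱ W X M A x T C) (s : ℝ) : Integrable (fun ω => besqSigma (X s ω) ^ 2) P := by
  refine ((S.Xi s).abs.const_mul 4).mono' ((S.Gm' s).pow_const 2).aestronglyMeasurable ?_
  refine Eventually.of_forall fun ω => ?_
  rw [Real.norm_of_nonneg (by positivity)]
  exact sigma_sq_le _

lemma G4 (S : Setup P ℱ W X M A x T C) : ∃ K, 0 ≤ K ∧ ∀ s, 0 ≤ s → s ≤ T →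
    HasLE P (fun ω => besqSigma (X s ω) ^ 4) K := by
  obtain ⟨K, hK, h⟩ := S.EX2
  refine ⟨16 * K, by positivity, fun s hs hsT => ?_⟩
  refine ((h s hs hsT).smul (c := 16) (by norm_num)).mono ((S.Gm' s).pow_const 4) fun ω => ?_
  rw [abs_of_nonneg (by positivity)]
  exact sigma_pow_four_le _

lemma eps (S : Setup P ℱ W X M A x T C) : ∃ K, 0 ≤ K ∧ ∀ s k, 0 ≤ s → 0 < k → k ≤ 1 →
    s + k ^ 4 ≤ T → HasLE P (fun ω => (M (s + k ^ 4) ω - M s ω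
      - besqSigma (X s ω) * (W (s + k ^ 4) ω - W s ω)) ^ 2) (K * k ^ 6) := by
  obtain ⟨K, hK, hdX⟩ := S.dX1
  refine ⟨4 * K, by positivity, fun s k hs hk hk1 hT => ?_⟩
  have hk4 : 0 < k ^ 4 := by positivity
  set t := s + k ^ 4 with ht
  have hst : s ≤ t := by linarith
  have hsT : s ≤ T := by linarith
  obtain ⟨K4, -, hG4⟩ := S.G4
  have hG4i := (hG4 s hs hsT).1
  -- W fourth moment
  have hW4 : ∀ r, 0 ≤ r → Integrable (fun ω => W r ω ^ 4) P := fun r hr => by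
    have := bm_pow_int S.bm le_rfl hr 4
    simpa [S.bm.start] using this
  -- the integrated squared difference
  have hdint : ∀ u, Integrable (fun ω => (besqSigma (X u ω) - besqSigma (X s ω)) ^ 2) P :=
    fun u => sq_subi (S.Gm' u) (S.Gm' s) (S.G2i u) (S.G2i s)
  have hF := fubini_bound (P := P) (H := fun u ω => (besqSigma (X u ω) - besqSigma (X s ω)) ^ 2)
    (s := s) (t := t) (L := 4 * (K * k ^ 2))
    (fun ω => ((sigma_cont.comp (S.cont ω)).sub continuous_const).pow 2)
    (fun u => ((S.Gm' u).sub (S.Gm' s)).pow_const 2) hst (fun u _ => hdint u)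
    (fun u hu => by
      have := ((hdX s u k hs hu.1.le hk hk1 hu.2 (hu.2.trans hT)).smul (c := 4) (by norm_num)).mono
        (f := fun ω => |(besqSigma (X u ω) - besqSigma (X s ω)) ^ 2|)
        (((S.Gm' u).sub (S.Gm' s)).pow_const 2).abs (fun ω => by
          rw [abs_abs, abs_of_nonneg (by positivity)]
          exact sigma_diff_sq _ _)
      exact this.2)
  -- pieces
  have p1 : HasE P (fun ω => (M t ω - M s ω) ^ 2)
      (∫ ω, (∫ u in Set.Ioc s t, besqSigma (X u ω) ^ 2) ∂P) :=
    ⟨S.dM2i hs hst hT, S.dM2_eq hs hst hT⟩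
  obtain ⟨K2, -, hS2⟩ := S.intS2
  have i2 := (hS2 s t hs hst hT).1
  have iG2 : Integrable (fun ω => k ^ 4 * besqSigma (X s ω) ^ 2) P := (S.G2i s).const_mul _
  have hpath : ∀ ω, (∫ u in Set.Ioc s t, besqSigma (X u ω) ^ 2)
      + (-2) * (besqSigma (X s ω) * ∫ u in Set.Ioc s t, besqSigma (X u ω))
      + k ^ 4 * besqSigma (X s ω) ^ 2
      = ∫ u in Set.Ioc s t, (besqSigma (X u ω) - besqSigma (X s ω)) ^ 2 := by
    intro ω
    have hc : Continuous fun u => besqSigma (X u ω) := sigma_cont.comp (S.cont ω)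
    rw [← intervalIntegral.integral_of_le hst, ← intervalIntegral.integral_of_le hst,
      ← intervalIntegral.integral_of_le hst]
    have e : ∀ u, (besqSigma (X u ω) - besqSigma (X s ω)) ^ 2 = besqSigma (X u ω) ^ 2
        - 2 * besqSigma (X s ω) * besqSigma (X u ω) + besqSigma (X s ω) ^ 2 := fun u => by ring
    simp_rw [e]
    rw [intervalIntegral.integral_add, intervalIntegral.integral_sub,
      intervalIntegral.integral_const_mul, intervalIntegral.integral_const]
    · rw [ht]; simp only [add_sub_cancel_left, smul_eq_mul]; ring
    all_goals apply Continuous.intervalIntegrable; fun_prop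
  have iGI : Integrable (fun ω => besqSigma (X s ω) * ∫ u in Set.Ioc s t, besqSigma (X u ω)) P := by
    have := (((i2.add iG2).sub hF.1).const_mul (1 / 2))
    refine this.congr (Eventually.of_forall fun ω => ?_)
    have := hpath ω
    simp only [Pi.add_apply, Pi.sub_apply]
    linarith
  have iWdM : Integrable (fun ω => (besqSigma (X s ω) * W s ω) * (M t ω - M s ω)) P :=
    four_i (S.Gm' s) (bm_meas S.bm s) ((S.Mm' t).sub (S.Mm' s)) hG4i (hW4 s hs) (S.dM2i hs hst hT)
  have p2 : HasE P (fun ω => (besqSigma (X s ω) * W s ω) * (M t ω - M s ω)) 0 :=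
    ⟨iWdM, mart_orth S.hM hst ((S.Gm s).mul (S.bm.adapted s)) iWdM⟩
  have iGM : Integrable (fun ω => besqSigma (X s ω) * M s ω) P :=
    prodi (S.Gm' s) (S.Mm' s) (S.G2i s) (S.M2i hs hsT)
  have p3 : HasE P (fun ω => (besqSigma (X s ω) * M s ω) * (W t ω - W s ω)) 0 := by
    refine ⟨?_, bm_mul_one S.bm hs hst ((S.Gm s).mul (S.Mm s))⟩
    have := bm_mul_int S.bm hs hst ((S.Gm s).mul (S.Mm s)) iGM 1
    simpa using this
  have iMW : ∀ r, 0 ≤ r → r ≤ T → Integrable (fun ω => besqSigma (X s ω) * W r ω * M r ω) P :=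
    fun r hr hrT => four_i (S.Gm' s) (bm_meas S.bm r) (S.Mm' r) hG4i (hW4 r hr) (S.M2i hr hrT)
  have iD : Integrable (fun ω => besqSigma (X s ω) *
      ((M t ω * W t ω - ∫ u in Set.Ioc (0 : ℝ) t, besqSigma (X u ω))
      - (M s ω * W s ω - ∫ u in Set.Ioc (0 : ℝ) s, besqSigma (X u ω)))) P := by
    refine (((iMW t (hs.trans hst) hT).sub (iMW s hs hsT)).sub iGI).congr
      (Eventually.of_forall fun ω => ?_)
    simp only [Pi.sub_apply]
    rw [splitInt (f := fun u => besqSigma (X u ω)) (sigma_cont.comp (S.cont ω)) hs hst]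
    ring
  have p4 : HasE P _ 0 := ⟨iD, mart_orth S.hD hst (S.Gm s) iD⟩
  have p5 : HasE P (fun ω => besqSigma (X s ω) ^ 2 * (W t ω - W s ω) ^ 2)
      ((∫ ω, besqSigma (X s ω) ^ 2 ∂P) * k ^ 4) := by
    refine ⟨bm_mul_int S.bm hs hst ((S.Gm s).pow_const 2) (S.G2i s) 2, ?_⟩
    rw [bm_mul_two S.bm hs hst ((S.Gm s).pow_const 2)]
    congr 1
    rw [ht]; ring
  have p6 : HasE P _ _ := ⟨iGI, rfl⟩
  have p7 : HasE P _ _ := ⟨i2, rfl⟩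
  have p8 : HasE P _ _ := ⟨S.G2i s, rfl⟩
  have tot := ((((p1.add (p2.smul 2)).add (p3.smul 2)).add (p4.smul (-2))).add (p6.smul (-2))).add p5
  have tot2 := ((p7.add (p6.smul (-2))).add (p8.smul (k ^ 4))).congr hpath
  have tot3 := tot.congr (g := fun ω => (M t ω - M s ω
      - besqSigma (X s ω) * (W t ω - W s ω)) ^ 2) (fun ω => by
    rw [splitInt (f := fun u => besqSigma (X u ω)) (sigma_cont.comp (S.cont ω)) hs hst]
    ring)
  refine ⟨tot3.1, ?_⟩
  rw [tot3.2]
  have e := tot2.2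
  have hF2 := hF.2
  rw [e] at hF2
  have e3 : 4 * (K * k ^ 2) * (t - s) = 4 * K * k ^ 6 := by rw [ht]; ring
  rw [e3] at hF2
  linarith

end Setup

lemma taylor_two (L v : ℝ) (hL : 0 ≤ L) (hLv : 0 ≤ L + v) :
    |Real.exp (-(L + v)) - Real.exp (-L) + Real.exp (-L) * v - 1 / 2 * (Real.exp (-L) * v ^ 2)|
      ≤ min (v ^ 2) (|v| ^ 3) := by
  have hE0 : 0 < Real.exp (-L) := Real.exp_pos _
  have hE1 : Real.exp (-L) ≤ 1 := Real.exp_le_one_iff.mpr (by linarith)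
  have hmul : Real.exp (-(L + v)) = Real.exp (-L) * Real.exp (-v) := by
    rw [← Real.exp_add]; congr 1; ring
  have hEv1 : Real.exp (-(L + v)) ≤ 1 := Real.exp_le_one_iff.mpr (by linarith)
  rw [hmul] at hEv1 ⊢
  have hEv0 : 0 < Real.exp (-v) := Real.exp_pos _
  set E := Real.exp (-L)
  set F := Real.exp (-v) with hF
  have e : E * F - E + E * v - 1 / 2 * (E * v ^ 2) = E * (F - 1 + v - v ^ 2 / 2) := by ring
  rcases le_or_gt |v| 1 with h | h
  · have hb := Real.exp_bound (x := -v) (by rwa [abs_neg]) (n := 3) (by norm_num)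
    rw [e, abs_mul, abs_of_pos hE0]
    have h1 : |F - 1 + v - v ^ 2 / 2| ≤ |v| ^ 3 := by
      have e2 : F - 1 + v - v ^ 2 / 2
          = F - ∑ i ∈ Finset.range 3, (-v) ^ i / (i.factorial : ℝ) := by
        simp [Finset.sum_range_succ, Nat.factorial]; ring
      rw [e2]
      refine hb.trans ?_
      rw [abs_neg]
      have : 0 ≤ |v| ^ 3 := by positivity
      norm_num [Nat.factorial]
      linarith
    have h2 : |v| ^ 3 ≤ v ^ 2 := by
      rw [← sq_abs]; exact pow_le_pow_of_le_one (abs_nonneg v) h (by norm_num)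
    rw [min_eq_right h2]
    calc E * |F - 1 + v - v ^ 2 / 2| ≤ 1 * |v| ^ 3 := by gcongr
      _ = |v| ^ 3 := one_mul _
  · have h2 : v ^ 2 ≤ |v| ^ 3 := by
      rw [← sq_abs]; exact pow_le_pow_right₀ h.le (by norm_num)
    rw [min_eq_left h2]
    have hv1 : 1 ≤ v ^ 2 := by
      rw [← sq_abs]; nlinarith
    rcases le_total 0 v with h0 | h0
    · have h3 : 1 - v ≤ F := by have := Real.add_one_le_exp (-v); linarith
      have h4 : F ≤ 1 := Real.exp_le_one_iff.mpr (by linarith)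
      have h5 : 1 < v := by rwa [abs_of_nonneg h0] at h
      rw [e, abs_mul, abs_of_pos hE0]
      have : |F - 1 + v - v ^ 2 / 2| ≤ v ^ 2 := by
        rw [abs_le]; constructor <;> nlinarith
      calc E * |F - 1 + v - v ^ 2 / 2| ≤ 1 * v ^ 2 := by gcongr
        _ = v ^ 2 := one_mul _
    · have h3 := Real.quadratic_le_exp_of_nonneg (x := -v) (by linarith)
      rw [← hF] at h3
      have h6 : 0 ≤ E * (F - 1 + v - v ^ 2 / 2) := by
        apply mul_nonneg hE0.le; nlinarith
      rw [e, abs_of_nonneg h6]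
      have h7 : 0 ≤ E * (1 - v + v ^ 2 / 2) := by
        apply mul_nonneg hE0.le; nlinarith
      nlinarith

lemma min_bound (a e : ℝ) : min ((a + e) ^ 2) (|a + e| ^ 3) ≤ 4 * e ^ 2 + 8 * |a| ^ 3 := by
  have h := abs_add_le a e
  have ha := abs_nonneg a
  have he := abs_nonneg e
  have h0 := abs_nonneg (a + e)
  have h8 : 0 ≤ 8 * |a| ^ 3 := by positivity
  rcases le_total |a| |e| with hc | hc
  · refine (min_le_left _ _).trans ?_
    rw [← sq_abs (a + e), ← sq_abs e]
    nlinarith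
  · refine (min_le_right _ _).trans ?_
    have : |a + e| ^ 3 ≤ (2 * |a|) ^ 3 := by gcongr; linarith
    nlinarith [sq_nonneg e]

lemma pointwise_bound (L a e k : ℝ) (hk : 0 < k) (hk1 : k ≤ 1) (hL : 0 ≤ L)
    (hLv : 0 ≤ L + (a + e)) :
    |Real.exp (-(L + (a + e))) - Real.exp (-L) + Real.exp (-L) * (a + e)
      - 1 / 2 * (Real.exp (-L) * a ^ 2)|
      ≤ 9 * k * a ^ 2 + 6 * k⁻¹ * e ^ 2 + 8 * (k ^ 2)⁻¹ * a ^ 4 := by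
  have h1 := (taylor_two L (a + e) hL hLv).trans (min_bound a e)
  have hE0 : 0 < Real.exp (-L) := Real.exp_pos _
  have hE1 : Real.exp (-L) ≤ 1 := Real.exp_le_one_iff.mpr (by linarith)
  set E := Real.exp (-L)
  have hkk : k ^ 2 ≤ k := by nlinarith
  have hki : 1 ≤ k⁻¹ := (one_le_inv₀ hk).mpr hk1
  have h3 : |a| ^ 3 ≤ k * a ^ 2 + (k ^ 2)⁻¹ * a ^ 4 := by
    have e4 : a ^ 4 = |a| ^ 4 := by rw [show |a| ^ 4 = (|a| ^ 2) ^ 2 by ring, sq_abs]; ring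
    rw [e4, ← sq_abs a]
    set y := |a|
    have hy : 0 ≤ y := abs_nonneg _
    have h5 : k ^ 2 * y ^ 2 + (k ^ 2)⁻¹ * y ^ 4 - y ^ 3
        = y ^ 2 * ((k ^ 2 - y) ^ 2 + k ^ 2 * y) / k ^ 2 := by field_simp; ring
    have h6 : 0 ≤ y ^ 2 * ((k ^ 2 - y) ^ 2 + k ^ 2 * y) / k ^ 2 := by positivity
    have h7 : k ^ 2 * y ^ 2 ≤ k * y ^ 2 := by gcongr
    linarith
  have h4 : |a * e| ≤ k * a ^ 2 + k⁻¹ * e ^ 2 := by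
    rw [abs_mul, ← sq_abs a, ← sq_abs e]
    have h5 : k * |a| ^ 2 + k⁻¹ * |e| ^ 2 - |a| * |e|
        = ((k * |a| - |e|) ^ 2 + k * |a| * |e|) / k := by field_simp; ring
    have h6 : 0 ≤ ((k * |a| - |e|) ^ 2 + k * |a| * |e|) / k := by positivity
    linarith
  have h5 : |1 / 2 * (E * (a + e) ^ 2) - 1 / 2 * (E * a ^ 2)| ≤ |a * e| + e ^ 2 := by
    have e5 : 1 / 2 * (E * (a + e) ^ 2) - 1 / 2 * (E * a ^ 2) = E * (a * e + e ^ 2 / 2) := by ring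
    rw [e5, abs_mul, abs_of_pos hE0]
    have h6 : |a * e + e ^ 2 / 2| ≤ |a * e| + e ^ 2 := by
      refine (abs_add_le _ _).trans ?_
      rw [abs_of_nonneg (by positivity : 0 ≤ e ^ 2 / 2)]
      nlinarith [sq_nonneg e]
    calc E * |a * e + e ^ 2 / 2| ≤ 1 * (|a * e| + e ^ 2) := by gcongr
      _ = _ := one_mul _
  have h6 : e ^ 2 ≤ k⁻¹ * e ^ 2 := by nlinarith [sq_nonneg e]
  have h7 := abs_add_le (Real.exp (-(L + (a + e))) - E + E * (a + e) - 1 / 2 * (E * (a + e) ^ 2))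
    (1 / 2 * (E * (a + e) ^ 2) - 1 / 2 * (E * a ^ 2))
  have e8 : Real.exp (-(L + (a + e))) - E + E * (a + e) - 1 / 2 * (E * (a + e) ^ 2) +
      (1 / 2 * (E * (a + e) ^ 2) - 1 / 2 * (E * a ^ 2))
      = Real.exp (-(L + (a + e))) - E + E * (a + e) - 1 / 2 * (E * a ^ 2) := by ring
  rw [e8] at h7
  nlinarith

lemma neg_part_bound (X a dM w : ℝ) (ha : 0 ≤ a) :
    max (-(X + a + dM)) 0 ^ 2 ≤ max (-X) 0 ^ 2 + (-2) * (max (-X) 0 * dM)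
      + 2 * (dM - besqSigma X * w) ^ 2 + 2 * w ^ 4 := by
  set ε := dM - besqSigma X * w with hε
  rcases le_total 0 X with h | h
  · rw [max_eq_right (a := -X) (by linarith)]
    have hsq : (Real.sqrt X) ^ 2 = X := Real.sq_sqrt h
    have hd : dM = 2 * Real.sqrt X * w + ε := by rw [hε]; unfold besqSigma; ring
    have h1 : max (-(X + a + dM)) 0 ≤ w ^ 2 + |ε| := by
      apply max_le
      · have := neg_abs_le ε
        nlinarith [sq_nonneg (Real.sqrt X + w)]
      · positivity
    have h2 : max (-(X + a + dM)) 0 ^ 2 ≤ (w ^ 2 + |ε|) ^ 2 := by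
      gcongr
    rw [← sq_abs ε]
    nlinarith [sq_nonneg (w ^ 2 - |ε|)]
  · rw [max_eq_left (a := -X) (by linarith)]
    have hs : besqSigma X = 0 := by unfold besqSigma; rw [Real.sqrt_eq_zero_of_nonpos h]; ring
    have hd : ε = dM := by rw [hε, hs]; ring
    rw [hd]
    have h1 : max (-(X + a + dM)) 0 ≤ |X + dM| := by
      apply max_le
      · have := neg_abs_le (X + dM); linarith
      · positivity
    have h2 : max (-(X + a + dM)) 0 ^ 2 ≤ |X + dM| ^ 2 := by gcongr
    rw [sq_abs] at h2
    have : 0 ≤ w ^ 4 := by positivity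
    nlinarith [sq_nonneg dM]

namespace Setup

variable {X M : ℝ → Ω → ℝ} {A : ℝ → ℝ} {x T C : ℝ}

lemma negi (S : Setup P ℱ W X M A x T C) {s : ℝ} (hs : 0 ≤ s) (hsT : s ≤ T) :
    Integrable (fun ω => max (-X s ω) 0 ^ 2) P := by
  obtain ⟨K, hK, h⟩ := S.EX2
  refine ((h s hs hsT).mono (((S.Xm s).neg.max measurable_const).pow_const 2) fun ω => ?_).1
  rw [abs_of_nonneg (by positivity), ← sq_abs (X s ω)]
  gcongr
  exact max_le (neg_le_abs _) (abs_nonneg _)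

lemma nonneg (S : Setup P ℱ W X M A x T C) {s : ℝ} (hs : 0 < s) (hsT : s ≤ T) :
    ∀ᵐ ω ∂P, 0 ≤ X s ω := by
  obtain ⟨K, hK, heps⟩ := S.eps
  have h := telescoping_le (fun s => ∫ ω, max (-X s ω) 0 ^ 2 ∂P) s (2 * K + 2 * gc4) hs (by
    intro r k hr hk hk1 hrk
    have hk4 : 0 < k ^ 4 := by positivity
    have hrT : r ≤ T := by linarith
    have hrkT : r + k ^ 4 ≤ T := hrk.trans hsT
    have hnm : Measurable[ℱ r] (fun ω => max (-X r ω) 0) :=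
      (S.adapted r).neg.max measurable_const
    have q1 : HasE P (fun ω => max (-X r ω) 0 ^ 2) _ := ⟨S.negi hr hrT, rfl⟩
    have q2 : HasE P _ _ := S.M_orth hr (by linarith : r ≤ r + k ^ 4) hrkT hnm (S.negi hr hrT)
    have q3 := heps r k hr hk hk1 hrkT
    have q4 : HasE P (fun ω => (W (r + k ^ 4) ω - W r ω) ^ 4) (gc4 * k ^ 8) := by
      refine ⟨bm_pow_int S.bm hr (by linarith) 4, ?_⟩
      have := bm_mul_four S.bm hr (by linarith : r ≤ r + k ^ 4) (Y := fun _ => 1) measurable_const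
      simp only [one_mul] at this
      rw [this, integral_const, probReal_univ, one_smul]; ring
    have tot := ((q1.add (q2.smul (-2))).hle.add (q3.smul (c := 2) (by norm_num))).add
      (q4.hle.smul (c := 2) (by norm_num))
    have q5 : (∫ ω, max (-X (r + k ^ 4) ω) 0 ^ 2 ∂P) ≤ _ := (tot.mono
      (((S.Xm (r + k ^ 4)).neg.max measurable_const).pow_const 2) (fun ω => by
        rw [abs_of_nonneg (by positivity)]
        have := neg_part_bound (X r ω) (A (r + k ^ 4) - A r) (M (r + k ^ 4) ω - M r ω)
          (W (r + k ^ 4) ω - W r ω) (by have := S.Amono r (r + k ^ 4) hr (by linarith); linarith)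
        have e : X (r + k ^ 4) ω = X r ω + (A (r + k ^ 4) - A r) + (M (r + k ^ 4) ω - M r ω) := by
          rw [S.hX, S.hX]; ring
        rw [Pi.neg_apply, e]
        exact this)).2
    have h6 : k ^ 6 ≤ k ^ 5 := pow_le_pow_of_le_one hk.le hk1 (by norm_num)
    have h8 : k ^ 8 ≤ k ^ 5 := pow_le_pow_of_le_one hk.le hk1 (by norm_num)
    have := gc4_nonneg
    nlinarith)
  have h0 : ∀ ω, max (-X 0 ω) 0 ^ 2 = 0 := by
    intro ω
    rw [S.hX, S.A0, S.M0, max_eq_right (by have := S.hx; linarith)]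
    norm_num
  simp only [h0, integral_zero] at h
  have h1 : ∫ ω, max (-X s ω) 0 ^ 2 ∂P = 0 := le_antisymm h (integral_nonneg fun ω => by positivity)
  rw [integral_eq_zero_iff_of_nonneg (fun ω => by positivity) (S.negi hs.le hsT)] at h1
  filter_upwards [h1] with ω hω
  have : max (-X s ω) 0 = 0 := by
    simpa using hω
  have h2 := le_max_left (-X s ω) 0
  linarith

end Setup

namespace Setup

variable {X M : ℝ → Ω → ℝ} {A : ℝ → ℝ} {x T C : ℝ}

lemma nonneg' (S : Setup P ℱ W X M A x T C) {s : ℝ} (hs : 0 ≤ s) (hsT : s ≤ T) :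
    ∀ᵐ ω ∂P, 0 ≤ X s ω := by
  rcases hs.eq_or_lt with h | h
  · subst h
    refine Eventually.of_forall fun ω => ?_
    rw [S.hX, S.A0, S.M0]
    have := S.hx
    linarith
  · exact S.nonneg h hsT

/-- The Riccati solution. -/
def phi (lam T s : ℝ) : ℝ := lam / (1 + 2 * lam * (T - s))

lemma phi_nonneg {lam T s : ℝ} (hl : 0 ≤ lam) (hs : s ≤ T) : 0 ≤ phi lam T s := by
  have : 0 ≤ T - s := by linarith
  unfold phi; positivity

lemma phi_le {lam T s : ℝ} (hl : 0 ≤ lam) (hs : s ≤ T) : phi lam T s ≤ lam := by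
  have : 0 ≤ T - s := by linarith
  unfold phi
  apply div_le_self hl
  have : 0 ≤ 2 * lam * (T - s) := by positivity
  linarith

lemma phi_diff {lam T s t : ℝ} (hl : 0 ≤ lam) (hs : s ≤ T) (ht : t ≤ T) :
    phi lam T t - phi lam T s = 2 * (t - s) * phi lam T s * phi lam T t := by
  have h1 : 0 ≤ T - s := by linarith
  have h2 : 0 ≤ T - t := by linarith
  have h3 : 1 + 2 * lam * (T - s) ≠ 0 := by positivity
  have h4 : 1 + 2 * lam * (T - t) ≠ 0 := by positivity
  unfold phi
  field_simp
  ring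

lemma rem_real {k p q lam R ρ : ℝ} (hk : 0 < k) (hq0 : 0 ≤ q) (hql : q ≤ lam) (hp0 : 0 ≤ p)
    (hpl : p ≤ lam) (hpq : q - p = 2 * k ^ 4 * p * q) (hr : |ρ| ≤ R * k ^ 8)
    (G w ε y : ℝ) :
    9 * k * (q * (G * w)) ^ 2 + 6 * k⁻¹ * (q * ε + (q - p) * y + ρ) ^ 2
      + 8 * (k ^ 2)⁻¹ * (q * (G * w)) ^ 4 ≤
      9 * k * lam ^ 2 * (G ^ 2 * w ^ 2) + 18 * k⁻¹ * lam ^ 2 * ε ^ 2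
      + 72 * k⁻¹ * lam ^ 4 * k ^ 8 * y ^ 2 + 18 * k⁻¹ * (R * k ^ 8) ^ 2
      + 8 * (k ^ 2)⁻¹ * lam ^ 4 * (G ^ 4 * w ^ 4) := by
  have hl : 0 ≤ lam := hq0.trans hql
  have hq2 : q ^ 2 ≤ lam ^ 2 := by gcongr
  have hq4 : q ^ 4 ≤ lam ^ 4 := by gcongr
  have b1 : 9 * k * (q * (G * w)) ^ 2 ≤ 9 * k * lam ^ 2 * (G ^ 2 * w ^ 2) := by
    calc 9 * k * (q * (G * w)) ^ 2 = 9 * k * q ^ 2 * (G ^ 2 * w ^ 2) := by ring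
      _ ≤ _ := by gcongr
  have b4 : 8 * (k ^ 2)⁻¹ * (q * (G * w)) ^ 4 ≤ 8 * (k ^ 2)⁻¹ * lam ^ 4 * (G ^ 4 * w ^ 4) := by
    have : 0 ≤ G ^ 4 * w ^ 4 := by positivity
    calc 8 * (k ^ 2)⁻¹ * (q * (G * w)) ^ 4 = 8 * (k ^ 2)⁻¹ * q ^ 4 * (G ^ 4 * w ^ 4) := by ring
      _ ≤ _ := by gcongr
  have hd : (q - p) ^ 2 ≤ 4 * lam ^ 4 * k ^ 8 := by
    rw [hpq]
    calc (2 * k ^ 4 * p * q) ^ 2 ≤ (2 * k ^ 4 * lam * lam) ^ 2 := by gcongr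
      _ = _ := by ring
  have hρ2 : ρ ^ 2 ≤ (R * k ^ 8) ^ 2 := by
    rw [← sq_abs ρ]; gcongr
  have g1 : (q * ε) ^ 2 ≤ lam ^ 2 * ε ^ 2 := by rw [mul_pow]; gcongr
  have g2 : ((q - p) * y) ^ 2 ≤ 4 * lam ^ 4 * k ^ 8 * y ^ 2 := by rw [mul_pow]; gcongr
  have tri : ∀ a b c : ℝ, (a + b + c) ^ 2 ≤ 3 * (a ^ 2 + b ^ 2 + c ^ 2) := fun a b c => by
    nlinarith [sq_nonneg (a - b), sq_nonneg (a - c), sq_nonneg (b - c)]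
  have b3 : (q * ε + (q - p) * y + ρ) ^ 2 ≤
      3 * (lam ^ 2 * ε ^ 2 + 4 * lam ^ 4 * k ^ 8 * y ^ 2 + (R * k ^ 8) ^ 2) := by
    have := tri (q * ε) ((q - p) * y) ρ
    linarith
  have b3' : 6 * k⁻¹ * (q * ε + (q - p) * y + ρ) ^ 2 ≤ 6 * k⁻¹ *
      (3 * (lam ^ 2 * ε ^ 2 + 4 * lam ^ 4 * k ^ 8 * y ^ 2 + (R * k ^ 8) ^ 2)) := by gcongr
  calc _ ≤ _ := add_le_add (add_le_add b1 b3') b4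
    _ = _ := by ring

set_option maxHeartbeats 4000000 in
lemma step (S : Setup P ℱ W X M A x T C) {lam R : ℝ} (hl : 0 ≤ lam) (hR : 0 ≤ R) (ψ : ℝ → ℝ)
    (hψ : ∀ s, 0 ≤ s → s ≤ T → 0 ≤ ψ s)
    (hρ : ∀ s k, 0 ≤ s → 0 < k → k ≤ 1 → s + k ^ 4 ≤ T →
      |phi lam T (s + k ^ 4) * (A (s + k ^ 4) - A s) - (ψ s - ψ (s + k ^ 4))| ≤ R * k ^ 8) :
    ∃ K, ∀ s k, 0 ≤ s → 0 < k → k ≤ 1 → s + k ^ 4 ≤ T →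
      |(∫ ω, Real.exp (-(phi lam T (s + k ^ 4) * max (X (s + k ^ 4) ω) 0 + ψ (s + k ^ 4))) ∂P)
        - ∫ ω, Real.exp (-(phi lam T s * max (X s ω) 0 + ψ s)) ∂P| ≤ K * k ^ 5 := by
  obtain ⟨K1, hK1, hE1⟩ := S.EX
  obtain ⟨K2, hK2, hE2⟩ := S.EX2
  obtain ⟨K4, hK4, hG4⟩ := S.G4
  obtain ⟨Ke, hKe, heps⟩ := S.eps
  have hg4 := gc4_nonneg
  refine ⟨(4 * lam ^ 3 * K1 + R) + (9 * lam ^ 2 * (4 * K1) + 18 * lam ^ 2 * Ke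
    + 72 * lam ^ 4 * K2 + 18 * R ^ 2 + 8 * lam ^ 4 * (K4 * gc4)), fun s k hs hk hk1 hT => ?_⟩
  have hk4 : 0 < k ^ 4 := by positivity
  have hr := hρ s k hs hk hk1 hT
  have hG2 := hG4 s hs (by linarith)
  have hep := heps s k hs hk hk1 hT
  have hX2 := hE2 s hs (by linarith)
  have hX1 := hE1 s hs (by linarith)
  set t := s + k ^ 4 with ht
  have hst : s ≤ t := by linarith
  have hsT : s ≤ T := by linarith
  have hts : t - s = k ^ 4 := by rw [ht]; ring
  set p := phi lam T s with hp
  set q := phi lam T t with hq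
  have hp0 : 0 ≤ p := phi_nonneg hl hsT
  have hq0 : 0 ≤ q := phi_nonneg hl hT
  have hpl : p ≤ lam := phi_le hl hsT
  have hql : q ≤ lam := phi_le hl hT
  have hpq : q - p = 2 * k ^ 4 * p * q := by rw [hq, hp, phi_diff hl hsT hT, hts]
  set ρ := q * (A t - A s) - (ψ s - ψ t) with hρdef
  set Z : Ω → ℝ := fun ω => Real.exp (-(p * max (X s ω) 0 + ψ s)) with hZ
  set Z' : Ω → ℝ := fun ω => Real.exp (-(q * max (X t ω) 0 + ψ t)) with hZ'
  have hZpos : ∀ ω, 0 < Z ω := fun ω => Real.exp_pos _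
  have hψs := hψ s hs hsT
  have hψt := hψ t (hs.trans hst) hT
  have hL : ∀ ω, 0 ≤ p * max (X s ω) 0 + ψ s := fun ω => by positivity
  have hZ1 : ∀ ω, Z ω ≤ 1 := fun ω => Real.exp_le_one_iff.mpr (by linarith [hL ω])
  have hZ'1 : ∀ ω, |Z' ω| ≤ 1 := fun ω => by
    rw [abs_of_pos (Real.exp_pos _)]
    have : 0 ≤ q * max (X t ω) 0 + ψ t := by positivity
    exact Real.exp_le_one_iff.mpr (by linarith)
  have hYm : Measurable[ℱ s] (fun ω => max (X s ω) 0) := (S.adapted s).max measurable_const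
  have hZm : Measurable[ℱ s] Z :=
    Real.measurable_exp.comp ((hYm.const_mul p).add_const (ψ s)).neg
  have hZm0 : Measurable Z := hZm.mono (ℱ.le s) le_rfl
  have hYm0 : Measurable (fun ω => max (X s ω) 0) := hYm.mono (ℱ.le s) le_rfl
  have hZ'm : Measurable Z' := by
    have : Measurable (fun ω => max (X t ω) 0) := (S.Xm t).max measurable_const
    exact Real.measurable_exp.comp ((this.const_mul q).add_const (ψ t)).neg
  have hZi : Integrable Z P := ((HasLE.const (P := P) 1).mono hZm0 fun ω => by
    rw [abs_of_pos (hZpos ω)]; exact hZ1 ω).1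
  have hZ'i : Integrable Z' P := ((HasLE.const (P := P) 1).mono hZ'm hZ'1).1
  have hZ2 : Integrable (fun ω => Z ω ^ 2) P := ((HasLE.const (P := P) 1).mono
    (hZm0.pow_const 2) fun ω => by
      rw [abs_of_nonneg (by positivity)]; have := hZ1 ω; have := hZpos ω; nlinarith).1
  -- linear pieces
  have q1 : HasE P _ _ := S.M_orth hs hst hT hZm hZ2
  have hZY : HasLE P (fun ω => Z ω * max (X s ω) 0) K1 := by
    refine HasLE.mono (g := fun ω => |X s ω|) ⟨(S.Xi s).abs, hX1⟩ (hZm0.mul hYm0) fun ω => ?_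
    have h1 := hZ1 ω
    have h2 := hZpos ω
    have h3 : 0 ≤ max (X s ω) 0 := le_max_right _ _
    rw [abs_of_nonneg (by positivity)]
    have h4 : max (X s ω) 0 ≤ |X s ω| := max_le (le_abs_self _) (abs_nonneg _)
    nlinarith
  set c := ∫ ω, Z ω * max (X s ω) 0 ∂P with hc
  have hc1 : c ≤ K1 := hZY.2
  have hc0 : 0 ≤ c := integral_nonneg fun ω => by
    have := hZpos ω
    positivity
  have q2 : HasE P (fun ω => Z ω * max (X s ω) 0) c := ⟨hZY.1, rfl⟩
  set z := ∫ ω, Z ω ∂P with hz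
  have hz0 : 0 ≤ z := integral_nonneg fun ω => (hZpos ω).le
  have hz1 : z ≤ 1 := by
    have := integral_mono hZi (integrable_const 1) hZ1
    simpa using this
  have q3 : HasE P Z z := ⟨hZi, rfl⟩
  have q4 : HasE P (fun ω => (Z ω * max (X s ω) 0) * (W t ω - W s ω) ^ 2) (c * k ^ 4) := by
    refine ⟨bm_mul_int S.bm hs hst (hZm.mul hYm) hZY.1 2, ?_⟩
    have h := bm_mul_two S.bm hs hst (Y := fun ω => Z ω * max (X s ω) 0) (hZm.mul hYm)
    rw [hts] at h
    exact h
  have lin := (((q1.smul (-q)).add (q2.smul (-(q - p)))).add (q3.smul (-ρ))).add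
    (q4.smul (2 * q ^ 2))
  -- remainder pieces
  have r1 : HasLE P (fun ω => besqSigma (X s ω) ^ 2 * (W t ω - W s ω) ^ 2) (4 * K1 * k ^ 4) := by
    refine ⟨bm_mul_int S.bm hs hst ((S.Gm s).pow_const 2) (S.G2i s) 2, ?_⟩
    rw [bm_mul_two S.bm hs hst ((S.Gm s).pow_const 2), hts]
    gcongr
    calc ∫ ω, besqSigma (X s ω) ^ 2 ∂P ≤ ∫ ω, 4 * |X s ω| ∂P :=
          integral_mono (S.G2i s) ((S.Xi s).abs.const_mul 4) fun ω => sigma_sq_le _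
      _ = 4 * ∫ ω, |X s ω| ∂P := integral_const_mul _ _
      _ ≤ 4 * K1 := by linarith
  have r4 : HasLE P (fun ω => besqSigma (X s ω) ^ 4 * (W t ω - W s ω) ^ 4) (K4 * gc4 * k ^ 8) := by
    refine ⟨bm_mul_int S.bm hs hst ((S.Gm s).pow_const 4) hG2.1 4, ?_⟩
    rw [bm_mul_four S.bm hs hst ((S.Gm s).pow_const 4), hts]
    calc _ ≤ K4 * (gc4 * (k ^ 4) ^ 2) := by gcongr; exact hG2.2
      _ = _ := by ring
  have rem := ((((r1.smul (c := 9 * k * lam ^ 2) (by positivity)).add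
    (hep.smul (c := 18 * k⁻¹ * lam ^ 2) (by positivity))).add
    (hX2.smul (c := 72 * k⁻¹ * lam ^ 4 * k ^ 8) (by positivity))).add
    (HasLE.const (18 * k⁻¹ * (R * k ^ 8) ^ 2))).add
    (r4.smul (c := 8 * (k ^ 2)⁻¹ * lam ^ 4) (by positivity))
  have hpt : ∀ᵐ ω ∂P, |Z' ω - Z ω - (-q * (Z ω * (M t ω - M s ω))
      + -(q - p) * (Z ω * max (X s ω) 0) + -ρ * Z ω
      + 2 * q ^ 2 * (Z ω * max (X s ω) 0 * (W t ω - W s ω) ^ 2))| ≤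
      9 * k * lam ^ 2 * (besqSigma (X s ω) ^ 2 * (W t ω - W s ω) ^ 2)
      + 18 * k⁻¹ * lam ^ 2 * (M t ω - M s ω - besqSigma (X s ω) * (W t ω - W s ω)) ^ 2
      + 72 * k⁻¹ * lam ^ 4 * k ^ 8 * X s ω ^ 2 + 18 * k⁻¹ * (R * k ^ 8) ^ 2
      + 8 * (k ^ 2)⁻¹ * lam ^ 4 * (besqSigma (X s ω) ^ 4 * (W t ω - W s ω) ^ 4) := by
    filter_upwards [S.nonneg' hs hsT, S.nonneg' (hs.trans hst) hT] with ω h1 h2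
    set w := W t ω - W s ω
    set G := besqSigma (X s ω) with hG
    have hGsq : G ^ 2 = 4 * X s ω := by rw [hG, sigma_sq, max_eq_left h1]
    set ε := M t ω - M s ω - G * w with hε
    have hXt : X t ω = X s ω + (A t - A s) + (M t ω - M s ω) := by rw [S.hX, S.hX]; ring
    have eL : p * X s ω + ψ s + (q * (G * w) + (q * ε + (q - p) * X s ω + ρ))
        = q * X t ω + ψ t := by
      rw [hXt, hε, hρdef]; ring
    have hpb := pointwise_bound (p * X s ω + ψ s) (q * (G * w)) (q * ε + (q - p) * X s ω + ρ) k hk hk1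
      (by positivity) (by rw [eL]; positivity)
    rw [eL] at hpb
    have eZ : Z ω = Real.exp (-(p * X s ω + ψ s)) := by simp only [hZ]; rw [max_eq_left h1]
    have eZ' : Z' ω = Real.exp (-(q * X t ω + ψ t)) := by simp only [hZ']; rw [max_eq_left h2]
    rw [← eZ, ← eZ'] at hpb
    rw [max_eq_left h1]
    have e1 : Z' ω - Z ω - (-q * (Z ω * (M t ω - M s ω)) + -(q - p) * (Z ω * X s ω) + -ρ * Z ω
        + 2 * q ^ 2 * (Z ω * X s ω * w ^ 2))
        = Z' ω - Z ω + Z ω * (q * (G * w) + (q * ε + (q - p) * X s ω + ρ))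
          - 1 / 2 * (Z ω * (q * (G * w)) ^ 2) := by
      have : (q * (G * w)) ^ 2 = q ^ 2 * (G ^ 2 * w ^ 2) := by ring
      rw [this, hGsq, hε]; ring
    rw [e1]
    refine hpb.trans ?_
    exact rem_real hk hq0 hql hp0 hpl hpq hr G w ε (X s ω)
  have hdiff := (hZ'i.sub hZi).sub lin.1
  simp only [← Real.norm_eq_abs] at hpt
  have hE := (norm_integral_le_of_norm_le rem.1 hpt).trans rem.2
  rw [Real.norm_eq_abs] at hE
  have hsplit : ∫ ω, (Z' ω - Z ω - (-q * (Z ω * (M t ω - M s ω))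
      + -(q - p) * (Z ω * max (X s ω) 0) + -ρ * Z ω
      + 2 * q ^ 2 * (Z ω * max (X s ω) 0 * (W t ω - W s ω) ^ 2))) ∂P
      = ((∫ ω, Z' ω ∂P) - z) - (-q * 0 + -(q - p) * c + -ρ * z + 2 * q ^ 2 * (c * k ^ 4)) := by
    rw [← lin.2, hz, ← integral_sub hZ'i hZi]
    exact integral_sub (hZ'i.sub hZi) lin.1
  rw [hsplit] at hE
  have hlin : |-q * 0 + -(q - p) * c + -ρ * z + 2 * q ^ 2 * (c * k ^ 4)|
      ≤ (4 * lam ^ 3 * K1 + R) * k ^ 8 := by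
    have e : -q * 0 + -(q - p) * c + -ρ * z + 2 * q ^ 2 * (c * k ^ 4)
        = 4 * k ^ 8 * p * q ^ 2 * c - ρ * z := by
      have : -q * 0 + -(q - p) * c + -ρ * z + 2 * q ^ 2 * (c * k ^ 4)
        = -(q - p) * c - ρ * z + 2 * q * k ^ 4 * c * (p + (q - p)) := by ring
      rw [this, hpq]; ring
    rw [e]
    refine (abs_sub _ _).trans ?_
    rw [abs_of_nonneg (by positivity), abs_mul, abs_of_nonneg hz0]
    have g1 : 4 * k ^ 8 * p * q ^ 2 * c ≤ 4 * k ^ 8 * lam * lam ^ 2 * K1 := by gcongr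
    have g2 : |ρ| * z ≤ R * k ^ 8 * 1 := by gcongr
    calc _ ≤ _ := add_le_add g1 g2
      _ = _ := by ring
  have habs := abs_add_le
    (((∫ ω, Z' ω ∂P) - z) - (-q * 0 + -(q - p) * c + -ρ * z + 2 * q ^ 2 * (c * k ^ 4)))
    (-q * 0 + -(q - p) * c + -ρ * z + 2 * q ^ 2 * (c * k ^ 4))
  rw [sub_add_cancel] at habs
  refine habs.trans ((add_le_add hE hlin).trans ?_)
  have k8 : k ^ 8 ≤ k ^ 5 := pow_le_pow_of_le_one hk.le hk1 (by norm_num)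
  have k7 : k ^ 7 ≤ k ^ 5 := pow_le_pow_of_le_one hk.le hk1 (by norm_num)
  have k6 : k ^ 6 ≤ k ^ 5 := pow_le_pow_of_le_one hk.le hk1 (by norm_num)
  have k15 : k ^ 15 ≤ k ^ 5 := pow_le_pow_of_le_one hk.le hk1 (by norm_num)
  have e1 : 9 * k * lam ^ 2 * (4 * K1 * k ^ 4) = 9 * lam ^ 2 * (4 * K1) * k ^ 5 := by ring
  have e2 : 18 * k⁻¹ * lam ^ 2 * (Ke * k ^ 6) = 18 * lam ^ 2 * Ke * k ^ 5 := by field_simp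
  have e3 : 72 * k⁻¹ * lam ^ 4 * k ^ 8 * K2 = 72 * lam ^ 4 * K2 * k ^ 7 := by field_simp
  have e4 : 18 * k⁻¹ * (R * k ^ 8) ^ 2 = 18 * R ^ 2 * k ^ 15 := by field_simp
  have e5 : 8 * (k ^ 2)⁻¹ * lam ^ 4 * (K4 * gc4 * k ^ 8) = 8 * lam ^ 4 * (K4 * gc4) * k ^ 6 := by
    field_simp
  rw [e1, e2, e3, e4, e5]
  have f3 : 72 * lam ^ 4 * K2 * k ^ 7 ≤ 72 * lam ^ 4 * K2 * k ^ 5 := by gcongr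
  have f4 : 18 * R ^ 2 * k ^ 15 ≤ 18 * R ^ 2 * k ^ 5 := by gcongr
  have f5 : 8 * lam ^ 4 * (K4 * gc4) * k ^ 6 ≤ 8 * lam ^ 4 * (K4 * gc4) * k ^ 5 := by gcongr
  have f6 : (4 * lam ^ 3 * K1 + R) * k ^ 8 ≤ (4 * lam ^ 3 * K1 + R) * k ^ 5 := by gcongr
  linarith

lemma laplace (S : Setup P ℱ W X M A x T C) {lam R : ℝ} (hl : 0 ≤ lam) (hR : 0 ≤ R) (ψ : ℝ → ℝ)
    (hψ : ∀ s, 0 ≤ s → s ≤ T → 0 ≤ ψ s) (hψT : ψ T = 0)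
    (hρ : ∀ s k, 0 ≤ s → 0 < k → k ≤ 1 → s + k ^ 4 ≤ T →
      |phi lam T (s + k ^ 4) * (A (s + k ^ 4) - A s) - (ψ s - ψ (s + k ^ 4))| ≤ R * k ^ 8) :
    ∫ ω, Real.exp (-(lam * X T ω)) ∂P = Real.exp (-(phi lam T 0 * x + ψ 0)) := by
  obtain ⟨K, hK⟩ := S.step hl hR ψ hψ hρ
  set f : ℝ → ℝ := fun s => ∫ ω, Real.exp (-(phi lam T s * max (X s ω) 0 + ψ s)) ∂P with hf
  have h1 := telescoping_le f T K S.hT (fun s k hs hk hk1 hT => by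
    have := (abs_le.mp (hK s k hs hk hk1 hT)).2
    simp only [hf]; linarith)
  have h2 := telescoping_le (fun s => -f s) T K S.hT (fun s k hs hk hk1 hT => by
    have := (abs_le.mp (hK s k hs hk hk1 hT)).1
    simp only [hf]; linarith)
  have h3 : f T = f 0 := le_antisymm h1 (by linarith)
  have h4 : f T = ∫ ω, Real.exp (-(lam * X T ω)) ∂P := by
    simp only [hf]
    apply integral_congr_ae
    filter_upwards [S.nonneg' S.hT.le le_rfl] with ω hω
    rw [max_eq_left hω, hψT]
    simp [phi]
  have h5 : f 0 = Real.exp (-(phi lam T 0 * x + ψ 0)) := by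
    have : ∀ ω, max (X 0 ω) 0 = x := fun ω => by
      rw [S.hX, S.A0, S.M0, max_eq_left (by have := S.hx; linarith)]; ring
    simp only [hf, this]
    simp
  rw [← h4, h3, h5]

end Setup

end GBESQAux

/-- Explicit Laplace transform of the time-`t` marginal of the generalized
squared Bessel process `Q^δ_x`. -/
theorem gbesq_marginal_laplace (δ : ℝ → ℝ) (hδ : MemD δ)
    (x t lam : ℝ) (hx : 0 ≤ x) (ht : 0 < t) (hlam : 0 ≤ lam)
    (μ : Measure RPath) (hμ : IsGBESQLaw (fun _ => 0) δ x μ) :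
    ∫ f, Real.exp (-(lam * f t)) ∂μ
      = Real.exp (-(lam * x) / (1 + 2 * lam * t)) *
        Real.exp (-(∫ u in Set.Ioc (0 : ℝ) t,
          lam * δ u / (1 + 2 * lam * (t - u)))) := by
  obtain ⟨⟨Ω, P, ℱ, W, X, prob, bm, sol, law⟩⟩ := hμ
  obtain ⟨hδm, hδ0, hδb, -⟩ := hδ
  obtain ⟨C, hC⟩ := hδb t
  have hC0 : 0 ≤ C := (hδ0 0).trans (hC 0 ⟨le_rfl, ht.le⟩)
  have hintg : ∀ a b : ℝ, 0 ≤ a → IntegrableOn δ (Set.Ioc a b) := by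
    intro a b ha
    obtain ⟨D, hD⟩ := hδb b
    refine Integrable.of_bound hδm.aestronglyMeasurable D ?_
    rw [ae_restrict_iff' measurableSet_Ioc]
    refine Eventually.of_forall fun u hu => ?_
    rw [Real.norm_of_nonneg (hδ0 u)]
    exact hD u ⟨by linarith [hu.1], hu.2⟩
  have hsplit : ∀ (g : ℝ → ℝ) (a b c : ℝ), a ≤ b → b ≤ c → IntegrableOn g (Set.Ioc a b) →
      IntegrableOn g (Set.Ioc b c) →
      ∫ u in Set.Ioc a c, g u = (∫ u in Set.Ioc a b, g u) + ∫ u in Set.Ioc b c, g u := by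
    intro g a b c hab hbc h1 h2
    rw [← Set.Ioc_union_Ioc_eq_Ioc hab hbc]
    exact setIntegral_union (Set.Ioc_disjoint_Ioc_of_le le_rfl) measurableSet_Ioc h1 h2
  have hdr : ∀ s y, gbesqDrift (fun _ => 0) δ s y = δ s := fun s y => by simp [gbesqDrift]
  have s1 := sol.drift_mart
  have s2 := sol.quad_var
  have s3 := sol.driven_by
  simp only [hdr] at s1 s2 s3
  have hAinc : ∀ a b, 0 ≤ a → a ≤ b → (∫ u in Set.Ioc (0 : ℝ) b, δ u)
      - (∫ u in Set.Ioc (0 : ℝ) a, δ u) = ∫ u in Set.Ioc a b, δ u := by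
    intro a b ha hab
    rw [hsplit δ 0 a b ha hab (hintg 0 a le_rfl) (hintg a b ha)]; ring
  have S : Setup P ℱ W X (fun s ω => X s ω - x - ∫ u in Set.Ioc (0 : ℝ) s, δ u)
      (fun s => ∫ u in Set.Ioc (0 : ℝ) s, δ u) x t C :=
    { bm := bm
      cont := sol.cont
      adapted := sol.adapted
      hX := fun s ω => by ring
      hx := hx
      hC := hC0
      hT := ht
      A0 := by simp
      Amono := fun a b ha hab => by
        have h1 := hAinc a b ha hab
        have h2 : 0 ≤ ∫ u in Set.Ioc a b, δ u := integral_nonneg fun u => hδ0 u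
        linarith
      Alip := fun a b ha hab hb => by
        rw [hAinc a b ha hab]
        have h1 : ∫ u in Set.Ioc a b, δ u ≤ ∫ u in Set.Ioc a b, C := by
          apply setIntegral_mono_on (hintg a b ha) (integrable_const C) measurableSet_Ioc
          intro u hu
          exact hC u ⟨by linarith [hu.1], hu.2.trans hb⟩
        refine h1.trans (le_of_eq ?_)
        rw [setIntegral_const]
        simp [Measure.real, hab]
        ring
      M0 := fun ω => by simp [show X 0 ω = x from sol.1 ω]
      hM := s1
      hQ := s2
      hD := s3 }
  have hphim : Measurable (fun u => lam * δ u / (1 + 2 * lam * (t - u))) := by fun_prop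
  have hfe : ∀ u, lam * δ u / (1 + 2 * lam * (t - u)) = Setup.phi lam t u * δ u := fun u => by
    unfold Setup.phi; ring
  have hpint : ∀ a b : ℝ, 0 ≤ a → b ≤ t →
      IntegrableOn (fun u => lam * δ u / (1 + 2 * lam * (t - u))) (Set.Ioc a b) := by
    intro a b ha hb
    refine Integrable.of_bound hphim.aestronglyMeasurable (lam * C) ?_
    rw [ae_restrict_iff' measurableSet_Ioc]
    refine Eventually.of_forall fun u hu => ?_
    have hut : u ≤ t := hu.2.trans hb
    have h1 := Setup.phi_nonneg hlam hut
    have h2 := Setup.phi_le hlam hut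
    have h3 := hδ0 u
    have h4 := hC u ⟨by linarith [hu.1], hut⟩
    rw [hfe, Real.norm_of_nonneg (by positivity)]
    gcongr
  have hlap := S.laplace hlam (R := 2 * lam ^ 2 * C) (by positivity)
    (fun s => ∫ u in Set.Ioc s t, lam * δ u / (1 + 2 * lam * (t - u))) (by
      intro s hs hst
      apply setIntegral_nonneg measurableSet_Ioc
      intro u hu
      rw [hfe]
      exact mul_nonneg (Setup.phi_nonneg hlam hu.2) (hδ0 u)) (by simp) (by
      intro s k hs hk hk1 hkt
      have hk4 : 0 < k ^ 4 := by positivity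
      have hle : s ≤ s + k ^ 4 := by linarith
      rw [hAinc s (s + k ^ 4) hs hle, hsplit _ s (s + k ^ 4) t hle hkt (hpint _ _ hs hkt)
        (hpint _ _ (by linarith) le_rfl), add_sub_cancel_right, ← integral_const_mul,
        ← integral_sub ((hintg _ _ hs).const_mul _) (hpint _ _ hs hkt)]
      have hb := norm_setIntegral_le_of_norm_le_const (μ := volume) (s := Set.Ioc s (s + k ^ 4))
        (f := fun u => Setup.phi lam t (s + k ^ 4) * δ u - lam * δ u / (1 + 2 * lam * (t - u)))
        (C := 2 * lam ^ 2 * C * k ^ 4) (by simp) (by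
          intro u hu
          have hut : u ≤ t := hu.2.trans hkt
          rw [hfe, ← sub_mul, Setup.phi_diff hlam hut hkt]
          have h1 := Setup.phi_nonneg hlam hut
          have h2 := Setup.phi_le hlam hut
          have h1' := Setup.phi_nonneg hlam hkt
          have h2' := Setup.phi_le hlam hkt
          have h3 := hδ0 u
          have h4 := hC u ⟨by linarith [hu.1], hut⟩
          have h5 : 0 ≤ s + k ^ 4 - u := by linarith [hu.2]
          have h6 : s + k ^ 4 - u ≤ k ^ 4 := by linarith [hu.1]
          rw [Real.norm_of_nonneg (by positivity)]
          calc _ ≤ 2 * k ^ 4 * lam * lam * C := by gcongr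
            _ = _ := by ring)
      refine hb.trans (le_of_eq ?_)
      rw [Real.volume_real_Ioc_of_le hle]
      ring)
  have hlaw : ∫ f, Real.exp (-(lam * f t)) ∂μ = ∫ ω, Real.exp (-(lam * X t ω)) ∂P := by
    rw [law, pathLaw, integral_map]
    · exact (measurable_pi_lambda _ fun s => S.Xm s).aemeasurable
    · have hm : Measurable (fun f : RPath => Real.exp (-(lam * f t))) := by fun_prop
      exact hm.aestronglyMeasurable
  rw [hlaw, hlap, ← Real.exp_add]
  congr 1
  simp only [Setup.phi, sub_zero]
  ring
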